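/- Let (X, μ) be a measure space, n ≥ 1 an integer, u : X → ℂ, ξ : X → ℂ measurable, and y : {1,…,n−1} → ℂ such that sinh(ξ(s) − y_k) ≠ 0 for all s ∈ X and all k. Define φ(a,b) = e^{b−a}/sinh(b−a), Ω = ∫_X u dμ, E(k) = ∫_X u(s)·φ(ξ(s), y_k) dμ(s), and Ṽ(j,k) = ∫_X u(s)·φ(ξ(s), y_j)·φ(ξ(s), y_k) dμ(s), and assume all of these integrands, as well as the n-fold integrand below, are integrable. Then (1/n!)·∫_{Xⁿ} (∏_{j=1}^n u(s_j))·D({ξ(s_j)}_{j=1}^n, {y_k}_{k=1}^{n−1}) dμⁿ = det M, where M is the n×n matrix with M(0,0) = Ω, M(0,k) = E(k) and M(j,0) = E(j) for 1 ≤ j,k ≤ n−1, and M(j,k) = Ṽ(j,k) for 1 ≤ j,k ≤ n−1. (Equivalently, when Ω ≠ 0 the left-hand side equals Ω·det_{n−1}(Ṽ(j,k) − E(j)E(k)/Ω).) -/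

import Mathlib

open MeasureTheory

/-- `φ(a,b) = e^{b−a}/sinh(b−a)`. -/
noncomputable def phiK (a b : ℂ) : ℂ := Complex.exp (b - a) / Complex.sinh (b - a)

/-- The squared generalized Cauchy determinant
`D({x_j},{y_k}) = [∏_{j<k} sinh²(x_j−x_k)]·[∏_{j<k} sinh²(y_j−y_k)] / ∏_{j,k} sinh²(x_j−y_k)`. -/
noncomputable def cauchySq {a b : ℕ} (x : Fin a → ℂ) (y : Fin b → ℂ) : ℂ :=
  ((∏ j : Fin a, ∏ k : Fin a, if j < k then Complex.sinh (x j - x k) ^ 2 else 1) *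
      (∏ j : Fin b, ∏ k : Fin b, if j < k then Complex.sinh (y j - y k) ^ 2 else 1)) /
    ∏ j : Fin a, ∏ k : Fin b, Complex.sinh (x j - y k) ^ 2

/-- The bordered matrix whose first column is constant one. -/
noncomputable def borderedMat {m : ℕ} (x : Fin (m + 1) → ℂ) (y : Fin m → ℂ) :
    Matrix (Fin (m + 1)) (Fin (m + 1)) ℂ :=
  Matrix.of fun j k => Fin.cases 1 (fun k' => phiK (x j) (y k')) k

/-- The hyperbolic Cauchy matrix. -/
noncomputable def hypCauchyMat {m : ℕ} (x : Fin m → ℂ) (y : Fin m → ℂ) :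
    Matrix (Fin m) (Fin m) ℂ :=
  Matrix.of fun j k => (Complex.sinh (y k - x j))⁻¹

lemma phiK_sub (a b c : ℂ) (h1 : Complex.sinh (c - a) ≠ 0) (h2 : Complex.sinh (c - b) ≠ 0) :
    phiK a c - phiK b c =
      Complex.sinh (a - b) * ((Complex.sinh (c - b))⁻¹ * (Complex.sinh (c - a))⁻¹) := by
  have e : a - b = (c - b) - (c - a) := by ring
  unfold phiK
  rw [e, Complex.sinh_sub (c - b) (c - a), ← Complex.cosh_add_sinh (c - a),
    ← Complex.cosh_add_sinh (c - b)]
  field_simp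
  ring

lemma sinh_ratio (a b c : ℂ) (h : Complex.sinh (c - a) ≠ 0) :
    Complex.sinh (b - a) * (Complex.sinh (c - a))⁻¹ =
      Complex.sinh (b - c) * phiK a c + Complex.exp (c - b) := by
  have e : b - a = (b - c) + (c - a) := by ring
  have e2 : c - b = -(b - c) := by ring
  unfold phiK
  rw [e, Complex.sinh_add, e2, ← Complex.cosh_add_sinh (c - a), ← Complex.cosh_add_sinh (-(b - c)),
    Complex.cosh_neg, Complex.sinh_neg]
  field_simp
  ring

lemma det_bordered {m : ℕ} (x : Fin (m + 1) → ℂ) (y : Fin m → ℂ)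
    (h : ∀ j k, Complex.sinh (y k - x j) ≠ 0) :
    (borderedMat x y).det = (∏ j : Fin m, Complex.sinh (x j.succ - x 0)) *
      ((∏ k : Fin m, (Complex.sinh (y k - x 0))⁻¹) *
        (hypCauchyMat (fun j => x j.succ) y).det) := by
  rw [Matrix.det_eq_of_forall_row_eq_smul_add_const (A := borderedMat x y)
    (B := Matrix.of fun i j => Fin.cases (borderedMat x y 0 j)
      (fun i' => borderedMat x y i'.succ j - borderedMat x y 0 j) i)
    (Fin.cases 0 (fun _ => 1)) 0 rfl]
  · rw [Matrix.det_succ_column_zero, Fin.sum_univ_succ]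
    rw [Finset.sum_eq_zero]
    · rw [← Matrix.det_mul_row, ← Matrix.det_mul_column]
      simp only [Fin.val_zero, pow_zero, one_mul, add_zero]
      have : (Matrix.of fun i j => Fin.cases (borderedMat x y 0 j)
        (fun i' => borderedMat x y i'.succ j - borderedMat x y 0 j) i :
          Matrix (Fin (m+1)) (Fin (m+1)) ℂ) 0 0 = 1 := rfl
      rw [this, one_mul]
      congr 1
      ext i j
      exact phiK_sub _ _ _ (h _ _) (h _ _)
    · intro i _
      simp [borderedMat]
  · intro i j
    refine Fin.cases ?_ (fun i' => ?_) i
    · simp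
    · simp

lemma det_hypCauchy {m : ℕ} (x : Fin (m + 1) → ℂ) (y : Fin (m + 1) → ℂ)
    (h : ∀ j k, Complex.sinh (y k - x j) ≠ 0) :
    (∏ j, Complex.sinh (y 0 - x j)) * (hypCauchyMat x y).det =
      (∏ k : Fin m, Complex.sinh (y 0 - y k.succ)) *
        (borderedMat x (fun k => y k.succ)).det := by
  have e : (∏ k : Fin m, Complex.sinh (y 0 - y k.succ)) =
      ∏ k : Fin (m + 1), (Fin.cases 1 (fun k' => Complex.sinh (y 0 - y k'.succ)) k : ℂ) := by
    rw [Fin.prod_univ_succ]; simp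
  rw [← Matrix.det_mul_column, e, ← Matrix.det_mul_row]
  refine (Matrix.det_transpose _).symm.trans (Eq.trans ?_ (Matrix.det_transpose _))
  refine Matrix.det_eq_of_forall_row_eq_smul_add_const
    (Fin.cases 0 (fun k' => Complex.exp (y k'.succ - y 0))) 0 rfl ?_
  intro j i
  refine Fin.cases ?_ (fun k => ?_) j
  · simp [borderedMat, hypCauchyMat, h]
  · have := sinh_ratio (x i) (y 0) (y k.succ) (h _ _)
    simpa [borderedMat, hypCauchyMat] using this

lemma tri_succ {n : ℕ} (g : Fin (n + 1) → ℂ) :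
    (∏ j, ∏ k, if j < k then Complex.sinh (g j - g k) ^ 2 else 1) =
      (∏ k : Fin n, Complex.sinh (g k.succ - g 0) ^ 2) *
        ∏ j : Fin n, ∏ k : Fin n,
          if j < k then Complex.sinh (g j.succ - g k.succ) ^ 2 else 1 := by
  rw [Fin.prod_univ_succ]
  congr 1
  · rw [Fin.prod_univ_succ]
    simp only [lt_self_iff_false, if_false, one_mul, Fin.succ_pos, if_true]
    refine Finset.prod_congr rfl fun k _ => ?_
    rw [← neg_sub, Complex.sinh_neg, neg_sq]
  · refine Finset.prod_congr rfl fun j _ => ?_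
    rw [Fin.prod_univ_succ]
    simp only [Fin.not_lt_zero, if_false, one_mul, Fin.succ_lt_succ_iff]

lemma cauchySq_eq : ∀ {m : ℕ} (x : Fin (m + 1) → ℂ) (y : Fin m → ℂ)
    (_ : ∀ j k, Complex.sinh (y k - x j) ≠ 0),
    cauchySq x y = (borderedMat x y).det ^ 2 := by
  intro m
  induction m with
  | zero => intro x y h; simp [cauchySq, borderedMat]
  | succ m ih =>
    intro x y h
    have h1 := det_bordered x y h
    have h2 := det_hypCauchy (fun j => x j.succ) y (fun j k => h _ _)
    have h3 := ih (fun j => x j.succ) (fun k => y k.succ) (fun j k => h _ _)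
    have sq : ∀ a b : ℂ, Complex.sinh (a - b) ^ 2 = Complex.sinh (b - a) ^ 2 := by
      intro a b
      rw [← neg_sub, Complex.sinh_neg, neg_sq]
    have n1 : (∏ j : Fin (m + 1), Complex.sinh (y 0 - x j.succ)) ≠ 0 :=
      Finset.prod_ne_zero_iff.2 fun j _ => h _ _
    have h4 : (hypCauchyMat (fun j => x j.succ) y).det =
      (∏ j : Fin (m + 1), Complex.sinh (y 0 - x j.succ))⁻¹ *
      ((∏ k : Fin m, Complex.sinh (y 0 - y k.succ)) *
        (borderedMat (fun j => x j.succ) (fun k => y k.succ)).det) := by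
      rw [← h2]; field_simp
    rw [h1, h4]
    simp only [mul_pow, ← h3, inv_pow, ← Finset.prod_pow]
    unfold cauchySq
    rw [tri_succ x, tri_succ y]
    rw [Fin.prod_univ_succ (n := m + 1) (f := fun j => ∏ k, Complex.sinh (x j - y k) ^ 2)]
    have e1 : (∏ j : Fin (m + 1), ∏ k, Complex.sinh (x j.succ - y k) ^ 2) =
        (∏ j : Fin (m + 1), Complex.sinh (y 0 - x j.succ) ^ 2) *
        ∏ j : Fin (m + 1), ∏ k : Fin m, Complex.sinh (x j.succ - y k.succ) ^ 2 := by
      rw [← Finset.prod_mul_distrib]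
      refine Finset.prod_congr rfl fun j _ => ?_
      rw [Fin.prod_univ_succ, sq (x j.succ) (y 0)]
    rw [e1]
    simp only [sq (x 0), sq (y 0) (y _)]
    rw [Finset.prod_inv_distrib]
    simp only [div_eq_mul_inv, mul_inv]
    ring

lemma andreief {X : Type*} [MeasurableSpace X] (μ : Measure X) [SigmaFinite μ]
    {n : ℕ} (u : X → ℂ) (f : Fin n → X → ℂ)
    (hi : ∀ j k, Integrable (fun s => u s * f j s * f k s) μ) :
    ∫ s : Fin n → X, (∏ j, u (s j)) * (Matrix.of fun j k => f k (s j)).det ^ 2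
      ∂(Measure.pi fun _ => μ) =
      (Nat.factorial n : ℂ) * (Matrix.of fun j k => ∫ s, u s * f j s * f k s ∂μ).det := by
  have e : ∀ s : Fin n → X, (∏ j, u (s j)) * (Matrix.of fun j k => f k (s j)).det ^ 2 =
      ∑ τ : Equiv.Perm (Fin n), ∑ σ : Equiv.Perm (Fin n),
        ((Equiv.Perm.sign τ : ℤ) : ℂ) * (((Equiv.Perm.sign σ : ℤ) : ℂ) *
          ∏ j, (u (s j) * f (σ j) (s j) * f (τ j) (s j))) := by
    intro s
    rw [← Matrix.det_transpose, pow_two, Matrix.det_apply', Finset.sum_mul_sum, Finset.mul_sum]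
    refine Finset.sum_congr rfl fun τ _ => ?_
    rw [Finset.mul_sum]
    refine Finset.sum_congr rfl fun σ _ => ?_
    simp only [Matrix.transpose_apply, Matrix.of_apply, Finset.prod_mul_distrib]
    ring
  have hI : ∀ σ τ : Equiv.Perm (Fin n), Integrable
      (fun s : Fin n → X => ∏ j, (u (s j) * f (σ j) (s j) * f (τ j) (s j)))
      (Measure.pi fun _ => μ) := fun σ τ =>
    Integrable.fintype_prod (f := fun j s => u s * f (σ j) s * f (τ j) s) fun j => hi _ _
  simp_rw [e]
  rw [integral_finsetSum _ fun τ _ => integrable_finsetSum _ fun σ _ =>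
    ((hI σ τ).const_mul _).const_mul _]
  have key : ∀ τ : Equiv.Perm (Fin n), ∫ s : Fin n → X, ∑ σ : Equiv.Perm (Fin n),
        ((Equiv.Perm.sign τ : ℤ) : ℂ) * (((Equiv.Perm.sign σ : ℤ) : ℂ) *
          ∏ j, (u (s j) * f (σ j) (s j) * f (τ j) (s j))) ∂(Measure.pi fun _ => μ) =
      (Matrix.of fun j k => ∫ s, u s * f j s * f k s ∂μ).det := by
    intro τ
    rw [integral_finsetSum _ fun σ _ => ((hI σ τ).const_mul _).const_mul _]
    simp_rw [integral_const_mul]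
    have hp : ∀ σ : Equiv.Perm (Fin n),
        ∫ s : Fin n → X, ∏ j, (u (s j) * f (σ j) (s j) * f (τ j) (s j)) ∂(Measure.pi fun _ => μ)
        = ∏ j, ∫ s, u s * f (σ j) s * f (τ j) s ∂μ := fun σ =>
      integral_fintype_prod_eq_prod (fun j s => u s * f (σ j) s * f (τ j) s)
    simp_rw [hp]
    rw [← Finset.mul_sum]
    have := Matrix.det_permute' τ (Matrix.of fun j k => ∫ s, u s * f j s * f k s ∂μ)
    rw [Matrix.det_apply'] at this
    simp only [Matrix.submatrix_apply, Matrix.of_apply, id] at this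
    rw [this, ← mul_assoc, ← Int.cast_mul, ← Units.val_mul, Int.units_mul_self]
    simp
  simp_rw [key]
  simp [Fintype.card_perm]

lemma pi_restrict_eq {X : Type*} [MeasurableSpace X] (μ : Measure X) (n : ℕ) (S : Set X)
    (hS : MeasurableSet S) [SigmaFinite (μ.restrict S)] :
    (Measure.pi fun _ : Fin n => μ).restrict (Set.univ.pi fun _ => S) =
      Measure.pi fun _ : Fin n => μ.restrict S := by
  symm
  refine Measure.pi_eq fun t ht => ?_
  have hB : MeasurableSet (Set.univ.pi fun i : Fin n => t i ∩ S) :=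
    MeasurableSet.univ_pi fun i => (ht i).inter hS
  have hp : ∏ i, (μ.restrict S) (t i) = ∏ i, μ (t i ∩ S) :=
    Finset.prod_congr rfl fun i _ => Measure.restrict_apply (ht i)
  rw [Measure.restrict_apply (MeasurableSet.univ_pi ht), ← Set.pi_inter_distrib]
  refine le_antisymm ?_ ?_
  · rw [Measure.pi, toMeasure_apply _ _ hB, hp]
    exact OuterMeasure.pi_pi_le _ _
  · have h1 : ∏ i, (μ.restrict S) (t i) =
        (Measure.pi fun _ : Fin n => μ.restrict S) (Set.univ.pi fun i : Fin n => t i ∩ S) := by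
      rw [Measure.pi_pi, hp]
      refine Finset.prod_congr rfl fun i _ => ?_
      rw [Measure.restrict_apply ((ht i).inter hS), Set.inter_assoc, Set.inter_self]
    rw [h1, Measure.pi, Measure.pi, toMeasure_apply _ _ hB, toMeasure_apply _ _ hB]
    have h2 : OuterMeasure.pi (fun _ : Fin n => (μ.restrict S).toOuterMeasure) ≤
        OuterMeasure.pi fun _ : Fin n => μ.toOuterMeasure := by
      rw [OuterMeasure.le_pi]
      intro s _
      refine (OuterMeasure.pi_pi_le _ _).trans ?_
      exact Finset.prod_le_prod' fun i _ => Measure.restrict_apply_le S (s i)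
    exact h2 _

/-- The Korepin–Slavnov resummation identity: the `n`-fold integral (`n = m+1`) of the
product weight times the squared generalized Cauchy determinant equals the determinant of
the bordered matrix built from `Ω`, `E` and `Ṽ`. -/
theorem korepin_slavnov_resummation {X : Type*} [MeasurableSpace X] (μ : Measure X)
    (m : ℕ) (u ξ : X → ℂ) (hu : Measurable u) (hξ : Measurable ξ)
    (y : Fin m → ℂ)
    (hsinh : ∀ s : X, ∀ k : Fin m, Complex.sinh (ξ s - y k) ≠ 0)
    (hInt0 : Integrable u μ)
    (hInt1 : ∀ k : Fin m, Integrable (fun s => u s * phiK (ξ s) (y k)) μ)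
    (hInt2 : ∀ j k : Fin m,
      Integrable (fun s => u s * phiK (ξ s) (y j) * phiK (ξ s) (y k)) μ)
    (hIntn : Integrable
      (fun s : Fin (m + 1) → X => (∏ j, u (s j)) * cauchySq (fun j => ξ (s j)) y)
      (Measure.pi fun _ => μ))
    (Ω : ℂ) (hΩ : Ω = ∫ s, u s ∂μ)
    (E : Fin m → ℂ) (hE : ∀ k, E k = ∫ s, u s * phiK (ξ s) (y k) ∂μ)
    (V : Fin m → Fin m → ℂ)
    (hV : ∀ j k, V j k = ∫ s, u s * phiK (ξ s) (y j) * phiK (ξ s) (y k) ∂μ)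
    (M : Matrix (Fin (m + 1)) (Fin (m + 1)) ℂ)
    (hM : ∀ j k, M j k =
      Fin.cases (Fin.cases Ω (fun k' => E k') k)
        (fun j' => Fin.cases (E j') (fun k' => V j' k') k) j) :
    (1 / (Nat.factorial (m + 1) : ℂ)) *
        ∫ s : Fin (m + 1) → X, (∏ j, u (s j)) * cauchySq (fun j => ξ (s j)) y
          ∂(Measure.pi fun _ => μ) = M.det := by
  have hfin : FinStronglyMeasurable u μ := by
    exact (memLp_one_iff_integrable.mpr hInt0).finStronglyMeasurable_of_stronglyMeasurable
      hu.stronglyMeasurable one_ne_zero ENNReal.one_ne_top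
  obtain ⟨S, hS, hS0, hσ⟩ := hfin.exists_set_sigmaFinite
  let f : Fin (m + 1) → X → ℂ := fun k s => Fin.cases 1 (fun k' => phiK (ξ s) (y k')) k
  have hs0 : ∀ k, f 0 k = 1 := fun _ => rfl
  have hss : ∀ k s, f (Fin.succ k) s = phiK (ξ s) (y k) := fun _ _ => rfl
  have hi : ∀ j k, Integrable (fun s => u s * f j s * f k s) μ := by
    intro j k
    refine Fin.cases ?_ (fun j => ?_) j <;> refine Fin.cases ?_ (fun k => ?_) k
    · simpa only [hs0, mul_one] using hInt0
    · simpa only [hs0, hss, mul_one] using hInt1 k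
    · simpa only [hs0, hss, mul_one] using hInt1 j
    · simpa only [hss] using hInt2 j k
  have hD : ∀ s : Fin (m + 1) → X, cauchySq (fun j => ξ (s j)) y =
      (Matrix.of fun j k => f k (s j)).det ^ 2 := by
    intro s
    refine cauchySq_eq _ _ fun j k => ?_
    rw [← neg_sub, Complex.sinh_neg]
    exact neg_ne_zero.2 (hsinh _ _)
  have hA := andreief (μ.restrict S) u f fun j k => (hi j k).restrict
  have hMd : M = Matrix.of fun j k => ∫ s in S, u s * f j s * f k s ∂μ := by
    ext j k
    rw [hM, Matrix.of_apply, setIntegral_eq_integral_of_forall_compl_eq_zero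
      (fun s hs => by rw [hS0 s hs]; ring)]
    refine Fin.cases ?_ (fun j => ?_) j <;> refine Fin.cases ?_ (fun k => ?_) k
    · simp only [hs0, mul_one]; exact hΩ
    · simp only [hs0, hss, mul_one]; exact hE k
    · simp only [hs0, hss, mul_one]; exact hE j
    · simp only [hss]; exact hV j k
  simp_rw [hD]
  rw [← pi_restrict_eq μ (m + 1) S hS, setIntegral_eq_integral_of_forall_compl_eq_zero, ← hMd] at hA
  · rw [hA]
    have : (Nat.factorial (m + 1) : ℂ) ≠ 0 := by exact_mod_cast Nat.factorial_ne_zero _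
    field_simp
  · intro s hs
    simp only [Set.mem_pi, Set.mem_univ, true_imp_iff, not_forall] at hs
    obtain ⟨i, hi⟩ := hs
    rw [Finset.prod_eq_zero (Finset.mem_univ i) (hS0 _ hi), zero_mul]
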